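/- For all positive integers ℓ_A, ℓ_B, the probability P(ℓ_A, ℓ_B) equals the single integral (1/π) ∫_0^π cot(θ/2) · sin(ℓ_B θ) · (p + √(p² − 1))^{−ℓ_A} dθ, where p = 2 − cos θ. -/

import Mathlib

open MeasureTheory Real

/-- Modified Bessel function of the first kind, integer order, defined by its series. -/
noncomputable def besselI (n : ℕ) (x : ℝ) : ℝ :=
  ∑' m : ℕ, (x / 2) ^ (n + 2 * m) / ((m.factorial : ℝ) * ((n + m).factorial : ℝ))

/-- Probability that walker `A` first reaches site `a` before walker `B` first reaches `b`. -/
noncomputable def Pfirst (a b : ℕ) : ℝ :=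
  (a : ℝ) * (b : ℝ) * ∫ tA in Set.Ioi (0 : ℝ),
    (Real.exp (-tA) * besselI a tA / tA) *
      ∫ tB in Set.Ioi tA, Real.exp (-tB) * besselI b tB / tB

theorem integral_cos_int_mul_zero_pi (k : ℤ) :
    ∫ θ in (0 : ℝ)..π, cos (k * θ) = if k = 0 then π else 0 := by
  split_ifs with hk
  · simp [hk]
  · have hk' : (k : ℝ) ≠ 0 := by exact_mod_cast hk
    rw [intervalIntegral.integral_comp_mul_left _ hk']
    simp [Real.sin_int_mul_pi]

theorem integral_sin_mul_sin_zero_pi (n a : ℕ) (ha : 1 ≤ a) :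
    ∫ θ in (0 : ℝ)..π, sin (n * θ) * sin (a * θ) = if n = a then π / 2 else 0 := by
  have key : ∀ θ : ℝ, sin (n * θ) * sin (a * θ) =
      (cos (((n - a : ℤ) : ℝ) * θ) - cos (((n + a : ℤ) : ℝ) * θ)) / 2 := by
    intro θ
    push_cast
    rw [sub_mul, add_mul, cos_sub, cos_add]
    ring
  simp_rw [key]
  rw [intervalIntegral.integral_div, intervalIntegral.integral_sub
    (Continuous.intervalIntegrable (by fun_prop) _ _)
    (Continuous.intervalIntegrable (by fun_prop) _ _),
    integral_cos_int_mul_zero_pi, integral_cos_int_mul_zero_pi]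
  have h1 : ¬ ((n : ℤ) + a = 0) := by omega
  have h2 : ((n : ℤ) - a = 0) ↔ n = a := by omega
  rw [if_neg h1]
  simp only [h2]
  split_ifs <;> simp

/-- The coefficients of the double power series of `exp (t / 2 * z) * exp (t / 2 * w)`. -/
noncomputable def expProdCoeff (t : ℝ) (x : ℕ × ℕ) : ℝ :=
  (t / 2) ^ x.1 / (x.1.factorial : ℝ) * ((t / 2) ^ x.2 / (x.2.factorial : ℝ))

theorem summable_abs_expProdCoeff (t : ℝ) : Summable fun x => |expProdCoeff t x| := by
  have h : Summable fun n : ℕ => ‖(t / 2) ^ n / (n.factorial : ℝ)‖ :=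
    (Real.summable_pow_div_factorial (t / 2)).norm
  have := summable_mul_of_summable_norm (f := fun n : ℕ => (t / 2) ^ n / (n.factorial : ℝ)) h h
  simpa only [expProdCoeff, abs_mul, norm_eq_abs, abs_abs] using this.norm

theorem hasSum_exp_mul_cos_mul_cos (n : ℕ) (t θ : ℝ) :
    HasSum (fun x : ℕ × ℕ => expProdCoeff t x * cos (((x.1 - x.2 - n : ℤ) : ℝ) * θ))
      (exp (t * cos θ) * cos (n * θ)) := by
  set z : ℂ := Complex.exp (θ * Complex.I) with hz
  set w : ℂ := Complex.exp (-θ * Complex.I) with hw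
  have hs : ∀ u : ℂ, HasSum (fun k : ℕ => u ^ k / (k.factorial : ℂ)) (Complex.exp u) := by
    intro u
    rw [Complex.exp_eq_exp_ℂ]
    exact NormedSpace.expSeries_div_hasSum_exp u
  have h1 := hs (t / 2 * z)
  have h2 := hs (t / 2 * w)
  have hsm := summable_mul_of_summable_norm h1.summable.norm h2.summable.norm
  have h3 := (h1.mul h2 hsm).mul_right (Complex.exp (-(n * θ) * Complex.I))
  have h4 := Complex.hasSum_re h3
  convert h4 using 1
  · funext x
    have : (t / 2 * z) ^ x.1 / (x.1.factorial : ℂ) * ((t / 2 * w) ^ x.2 / (x.2.factorial : ℂ)) *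
        Complex.exp (-(n * θ) * Complex.I) = ((expProdCoeff t x : ℝ) : ℂ) *
        Complex.exp (((((x.1 - x.2 - n : ℤ) : ℝ) * θ : ℝ) : ℂ) * Complex.I) := by
      have : Complex.exp (((((x.1 - x.2 - n : ℤ) : ℝ) * θ : ℝ) : ℂ) * Complex.I) =
          z ^ x.1 * w ^ x.2 * Complex.exp (-(n * θ) * Complex.I) := by
        rw [hz, hw, ← Complex.exp_nat_mul, ← Complex.exp_nat_mul, ← Complex.exp_add,
          ← Complex.exp_add]
        congr 1
        push_cast
        ring
      rw [this, expProdCoeff]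
      push_cast
      rw [mul_pow, mul_pow]
      ring
    rw [this, Complex.re_ofReal_mul, Complex.exp_ofReal_mul_I_re]
  · have : Complex.exp (t / 2 * z) * Complex.exp (t / 2 * w) *
        Complex.exp (-(n * θ) * Complex.I) =
        ((exp (t * cos θ) : ℝ) : ℂ) * Complex.exp (((-(n * θ) : ℝ) : ℂ) * Complex.I) := by
      rw [← Complex.exp_add]
      push_cast
      congr 2
      rw [Complex.cos, hz, hw]
      ring
    rw [this, Complex.re_ofReal_mul, Complex.exp_ofReal_mul_I_re, cos_neg]

theorem integral_exp_mul_cos_mul_cos (n : ℕ) (t : ℝ) :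
    ∫ θ in (0 : ℝ)..π, exp (t * cos θ) * cos (n * θ) = π * besselI n t := by
  have h : HasSum (fun x : ℕ × ℕ =>
      ∫ θ in (0 : ℝ)..π, expProdCoeff t x * cos (((x.1 - x.2 - n : ℤ) : ℝ) * θ))
      (∫ θ in (0 : ℝ)..π, exp (t * cos θ) * cos (n * θ)) := by
    apply intervalIntegral.hasSum_integral_of_dominated_convergence
      (fun x _ => |expProdCoeff t x|)
    · intro x
      exact Continuous.aestronglyMeasurable (by fun_prop)
    · intro x
      refine .of_forall fun θ _ => ?_
      rw [norm_mul]
      exact mul_le_of_le_one_right (norm_nonneg _) (abs_cos_le_one _)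
    · exact .of_forall fun θ _ => summable_abs_expProdCoeff t
    · simp
    · exact .of_forall fun θ _ => hasSum_exp_mul_cos_mul_cos n t θ
  simp_rw [intervalIntegral.integral_const_mul, integral_cos_int_mul_zero_pi] at h
  have hg : Function.Injective fun m : ℕ => ((n + m, m) : ℕ × ℕ) := by
    intro m m' hm
    simpa using congrArg Prod.snd hm
  rw [← hg.hasSum_iff] at h
  · rw [← h.tsum_eq, besselI, ← tsum_mul_left]
    congr 1
    funext m
    simp only [Function.comp, expProdCoeff]
    have : ((n + m : ℕ) : ℤ) - m - n = 0 := by push_cast; ring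
    rw [if_pos this, two_mul, ← add_assoc, pow_add _ (n + m)]
    field_simp
  · rintro ⟨j, k⟩ hx
    have : ¬ ((j : ℤ) - k - n = 0) := by
      intro hjk
      exact hx ⟨k, Prod.ext (by simp; omega) rfl⟩
    simp [this]

/-- The kernel whose integral over `θ` represents first-passage densities. -/
noncomputable def passageKernel (p : ℝ) (b : ℕ) (t θ : ℝ) : ℝ :=
  exp (-(p - cos θ) * t) * (sin θ * sin (b * θ))

theorem continuous_passageKernel (p : ℝ) (b : ℕ) :
    Continuous (Function.uncurry (passageKernel p b)) := by
  unfold passageKernel Function.uncurry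
  fun_prop

theorem besselI_density_eq_integral (p : ℝ) (b : ℕ) {t : ℝ} (ht : 0 < t) :
    b * (exp (-p * t) * besselI b t / t) =
      1 / π * ∫ θ in Set.Ioc 0 π, passageKernel p b t θ := by
  have hparts : ∫ θ in (0 : ℝ)..π,
      (b * (exp (t * cos θ) * cos (b * θ)) - t * (exp (t * cos θ) * (sin θ * sin (b * θ)))) = 0 := by
    rw [intervalIntegral.integral_eq_sub_of_hasDerivAt
      (f := fun θ => exp (t * cos θ) * sin (b * θ))]
    · simp
    · intro θ _
      have h1 : HasDerivAt (fun θ : ℝ => exp (t * cos θ)) (exp (t * cos θ) * (t * -sin θ)) θ :=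
        ((hasDerivAt_cos θ).const_mul t).exp
      have h2 : HasDerivAt (fun θ : ℝ => sin (b * θ)) (cos (b * θ) * (b * 1)) θ :=
        ((hasDerivAt_id θ).const_mul (b : ℝ)).sin
      refine (h1.mul h2).congr_deriv ?_
      ring
    · exact Continuous.intervalIntegrable (by fun_prop) _ _
  rw [intervalIntegral.integral_sub (Continuous.intervalIntegrable (by fun_prop) _ _)
    (Continuous.intervalIntegrable (by fun_prop) _ _), intervalIntegral.integral_const_mul,
    intervalIntegral.integral_const_mul, integral_exp_mul_cos_mul_cos] at hparts
  have hK : ∀ θ, passageKernel p b t θ =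
      exp (-p * t) * (exp (t * cos θ) * (sin θ * sin (b * θ))) := by
    intro θ
    have : exp (-(p - cos θ) * t) = exp (-p * t) * exp (t * cos θ) := by
      rw [← exp_add]
      congr 1
      ring
    rw [passageKernel, this, mul_assoc]
  simp_rw [hK]
  rw [integral_const_mul, ← intervalIntegral.integral_of_le pi_pos.le]
  generalize (∫ θ in (0 : ℝ)..π, exp (t * cos θ) * (sin θ * sin (b * θ))) = J at hparts ⊢
  have := pi_ne_zero
  field_simp
  linear_combination hparts

theorem abs_sin_nat_mul_le (n : ℕ) (θ : ℝ) : |sin (n * θ)| ≤ n * |sin θ| := by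
  induction n with
  | zero => simp
  | succ n ih =>
    push_cast
    rw [add_mul, one_mul, sin_add]
    have h1 : |sin (n * θ) * cos θ| ≤ |sin (n * θ)| := by
      rw [abs_mul]
      exact mul_le_of_le_one_right (abs_nonneg _) (abs_cos_le_one _)
    have h2 : |cos (n * θ) * sin θ| ≤ |sin θ| := by
      rw [abs_mul]
      exact mul_le_of_le_one_left (abs_nonneg _) (abs_cos_le_one _)
    linarith [abs_add_le (sin (n * θ) * cos θ) (cos (n * θ) * sin θ)]

theorem abs_sin_mul_sin_div_le {p : ℝ} (hp : 1 ≤ p) (b : ℕ) {θ : ℝ} (hθ : 0 < p - cos θ) :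
    |sin θ * sin (b * θ) / (p - cos θ)| ≤ 2 * b := by
  rw [abs_div, abs_of_pos hθ, div_le_iff₀ hθ, abs_mul]
  have h1 := abs_sin_nat_mul_le b θ
  have hb : (0 : ℝ) ≤ b := b.cast_nonneg
  have h2 : |sin θ| * |sin θ| ≤ 2 * (p - cos θ) := by
    rw [abs_mul_abs_self]
    nlinarith [sin_sq_add_cos_sq θ, cos_le_one θ, neg_one_le_cos θ]
  nlinarith [mul_le_mul_of_nonneg_left h1 (abs_nonneg (sin θ)), mul_le_mul_of_nonneg_left h2 hb]

theorem sub_cos_pos {p θ : ℝ} (hp : 1 ≤ p) (hθ : θ ∈ Set.Ioc 0 π) : 0 < p - cos θ := by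
  have : cos θ < cos 0 := strictAntiOn_cos ⟨le_rfl, pi_pos.le⟩ ⟨hθ.1.le, hθ.2⟩ hθ.1
  rw [cos_zero] at this
  linarith

theorem integral_Ioi_passageKernel {p θ : ℝ} (h : 0 < p - cos θ) (b : ℕ) (c : ℝ) :
    ∫ t in Set.Ioi c, passageKernel p b t θ =
      exp (-(p - cos θ) * c) * (sin θ * sin (b * θ) / (p - cos θ)) := by
  unfold passageKernel
  rw [integral_mul_const, integral_exp_mul_Ioi (neg_lt_zero.mpr h), neg_div_neg_eq]
  ring

theorem integrable_passageKernel {p : ℝ} (hp : 1 ≤ p) (b : ℕ) {c : ℝ} (hc : 0 ≤ c) :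
    Integrable (Function.uncurry (passageKernel p b))
      ((volume.restrict (Set.Ioi c)).prod (volume.restrict (Set.Ioc 0 π))) := by
  rw [integrable_prod_iff' (continuous_passageKernel p b).aestronglyMeasurable]
  constructor
  · filter_upwards [ae_restrict_mem measurableSet_Ioc] with θ hθ
    have h := sub_cos_pos hp hθ
    exact (integrableOn_exp_mul_Ioi (neg_lt_zero.mpr h) c).mul_const (sin θ * sin (b * θ))
  · have : Integrable (fun _ : ℝ => (2 * b : ℝ)) (volume.restrict (Set.Ioc 0 π)) :=
      integrable_const _
    refine this.mono' ?_ ?_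
    · have hm := (continuous_passageKernel p b).norm.stronglyMeasurable
      exact hm.integral_prod_left'.aestronglyMeasurable
    · filter_upwards [ae_restrict_mem measurableSet_Ioc] with θ hθ
      have h := sub_cos_pos hp hθ
      have h1 : ∀ t, ‖Function.uncurry (passageKernel p b) (t, θ)‖ =
          exp (-(p - cos θ) * t) * |sin θ * sin (b * θ)| := by
        intro t
        simp [Function.uncurry, passageKernel, abs_mul]
      simp_rw [h1]
      rw [integral_mul_const, integral_exp_mul_Ioi (neg_lt_zero.mpr h), neg_div_neg_eq, norm_mul,
        norm_div, norm_of_nonneg h.le, norm_of_nonneg (exp_pos _).le, norm_of_nonneg (abs_nonneg _)]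
      have h2 := abs_sin_mul_sin_div_le hp b h
      rw [abs_div, abs_of_pos h] at h2
      have h3 : exp (-(p - cos θ) * c) ≤ 1 := by
        rw [exp_le_one_iff]
        nlinarith
      calc _ = exp (-(p - cos θ) * c) * (|sin θ * sin (b * θ)| / (p - cos θ)) := by ring
        _ ≤ 1 * (2 * b) := by gcongr
        _ = _ := one_mul _

theorem hasSum_pow_mul_sin {q : ℝ} (h0 : 0 ≤ q) (h1 : q < 1) (θ : ℝ) :
    HasSum (fun n : ℕ => q ^ n * sin (n * θ)) (q * sin θ / (1 - 2 * q * cos θ + q ^ 2)) := by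
  have hnorm : ‖(q : ℂ) * Complex.exp (θ * Complex.I)‖ < 1 := by
    rw [norm_mul, Complex.norm_exp_ofReal_mul_I, mul_one, Complex.norm_real,
      norm_of_nonneg h0]
    exact h1
  have h := Complex.hasSum_im (hasSum_geometric_of_norm_lt_one hnorm)
  convert h using 1
  · funext n
    rw [mul_pow, ← Complex.exp_nat_mul, ← mul_assoc, ← Complex.ofReal_pow,
      Complex.im_ofReal_mul, ← Complex.ofReal_natCast, ← Complex.ofReal_mul,
      Complex.exp_ofReal_mul_I_im]
  · rw [Complex.inv_im, Complex.normSq_apply]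
    simp only [Complex.sub_re, Complex.sub_im, Complex.one_re, Complex.one_im,
      Complex.re_ofReal_mul, Complex.im_ofReal_mul, Complex.exp_ofReal_mul_I_re,
      Complex.exp_ofReal_mul_I_im]
    congr 1
    · ring
    · linear_combination (-q ^ 2) * sin_sq_add_cos_sq θ

theorem integral_sin_mul_geometric {q : ℝ} (h0 : 0 ≤ q) (h1 : q < 1) {a : ℕ} (ha : 1 ≤ a) :
    ∫ θ in (0 : ℝ)..π, q * sin θ / (1 - 2 * q * cos θ + q ^ 2) * sin (a * θ) =
      q ^ a * (π / 2) := by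
  have h : HasSum (fun n : ℕ => ∫ θ in (0 : ℝ)..π, q ^ n * (sin (n * θ) * sin (a * θ)))
      (∫ θ in (0 : ℝ)..π, q * sin θ / (1 - 2 * q * cos θ + q ^ 2) * sin (a * θ)) := by
    apply intervalIntegral.hasSum_integral_of_dominated_convergence (fun n _ => q ^ n)
    · intro n
      exact Continuous.aestronglyMeasurable (by fun_prop)
    · intro n
      refine .of_forall fun θ _ => ?_
      rw [norm_mul, norm_of_nonneg (pow_nonneg h0 n), norm_mul]
      exact mul_le_of_le_one_right (pow_nonneg h0 n)
        (mul_le_one₀ (abs_sin_le_one _) (norm_nonneg _) (abs_sin_le_one _))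
    · exact .of_forall fun θ _ => summable_geometric_of_lt_one h0 h1
    · simp
    · refine .of_forall fun θ _ => ?_
      simpa only [mul_assoc] using (hasSum_pow_mul_sin h0 h1 θ).mul_right (sin (a * θ))
  simp_rw [intervalIntegral.integral_const_mul, integral_sin_mul_sin_zero_pi _ a ha] at h
  refine h.unique ?_
  convert hasSum_single a ?_ using 1
  · simp
  · intro n hn
    simp [hn]

theorem integral_sin_mul_sin_div_sub_cos {p : ℝ} (hp : 1 < p) {a : ℕ} (ha : 1 ≤ a) :
    ∫ θ in Set.Ioc 0 π, sin θ * sin (a * θ) / (p - cos θ) =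
      π * (p + √(p ^ 2 - 1)) ^ (-(a : ℤ)) := by
  set r := p + √(p ^ 2 - 1) with hr
  have hsq : √(p ^ 2 - 1) ^ 2 = p ^ 2 - 1 := sq_sqrt (by nlinarith)
  have hr1 : 1 < r := by linarith [sqrt_nonneg (p ^ 2 - 1)]
  have hr0 : 0 < r := by linarith
  have hpr : 2 * p * r = r ^ 2 + 1 := by
    rw [hr]
    linear_combination -hsq
  have h := integral_sin_mul_geometric (inv_nonneg.mpr hr0.le) (inv_lt_one_of_one_lt₀ hr1) ha
  rw [← intervalIntegral.integral_of_le pi_pos.le]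
  have hcongr : ∀ θ : ℝ, sin θ * sin (a * θ) / (p - cos θ) =
      2 * (r⁻¹ * sin θ / (1 - 2 * r⁻¹ * cos θ + r⁻¹ ^ 2) * sin (a * θ)) := by
    intro θ
    have h1 : 0 < p - cos θ := by linarith [cos_le_one θ]
    have h2 : 1 - 2 * r⁻¹ * cos θ + r⁻¹ ^ 2 = 2 * r⁻¹ * (p - cos θ) := by
      field_simp
      linear_combination -hpr
    rw [h2]
    field_simp
  simp_rw [hcongr]
  rw [intervalIntegral.integral_const_mul, h, zpow_neg, zpow_natCast, inv_pow]
  ring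

theorem integrable_besselI_density {p : ℝ} (hp : 1 ≤ p) (b : ℕ) :
    Integrable (fun t => b * (exp (-p * t) * besselI b t / t)) (volume.restrict (Set.Ioi 0)) := by
  refine ((integrable_passageKernel hp b le_rfl).integral_prod_left.const_mul (1 / π)).congr ?_
  filter_upwards [ae_restrict_mem measurableSet_Ioi] with t ht
  exact (besselI_density_eq_integral p b ht).symm

theorem integral_Ioi_besselI_density {p : ℝ} (hp : 1 ≤ p) (b : ℕ) {c : ℝ} (hc : 0 ≤ c) :
    ∫ t in Set.Ioi c, b * (exp (-p * t) * besselI b t / t) =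
      1 / π * ∫ θ in Set.Ioc 0 π,
        exp (-(p - cos θ) * c) * (sin θ * sin (b * θ) / (p - cos θ)) := by
  rw [setIntegral_congr_fun measurableSet_Ioi fun t ht =>
    besselI_density_eq_integral p b (hc.trans_lt ht), integral_const_mul,
    integral_integral_swap (integrable_passageKernel hp b hc)]
  congr 1
  exact setIntegral_congr_fun measurableSet_Ioc fun θ hθ =>
    integral_Ioi_passageKernel (sub_cos_pos hp hθ) b c

theorem integral_besselI_density_laplace {p : ℝ} (hp : 1 < p) {a : ℕ} (ha : 1 ≤ a) :
    ∫ t in Set.Ioi 0, a * (exp (-p * t) * besselI a t / t) =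
      (p + √(p ^ 2 - 1)) ^ (-(a : ℤ)) := by
  rw [integral_Ioi_besselI_density hp.le a le_rfl]
  simp_rw [mul_zero, exp_zero, one_mul]
  rw [integral_sin_mul_sin_div_sub_cos hp ha, ← mul_assoc, one_div_mul_cancel pi_ne_zero, one_mul]

theorem sin_div_one_sub_cos_eq_cot_half {θ : ℝ} (hθ : θ ∈ Set.Ioc 0 π) :
    sin θ / (1 - cos θ) = cos (θ / 2) / sin (θ / 2) := by
  have h : 0 < sin (θ / 2) :=
    sin_pos_of_pos_of_lt_pi (by linarith [hθ.1]) (by linarith [hθ.1, hθ.2])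
  have h1 : sin θ = 2 * sin (θ / 2) * cos (θ / 2) := by
    rw [← sin_two_mul]
    ring_nf
  have h2 : 1 - cos θ = 2 * sin (θ / 2) ^ 2 := by
    rw [sin_sq_eq_half_sub]
    ring_nf
  rw [h1, h2]
  field_simp

/-- The product of the density for `A` and the spectral form of the survival function for `B`. -/
theorem integrable_density_mul_survival (a b : ℕ) :
    Integrable (Function.uncurry fun t θ : ℝ => a * (exp (-1 * t) * besselI a t / t) *
        (exp (-(1 - cos θ) * t) * (sin θ * sin (b * θ) / (1 - cos θ))))
      ((volume.restrict (Set.Ioi 0)).prod (volume.restrict (Set.Ioc 0 π))) := by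
  have hf := (integrable_besselI_density le_rfl a).comp_fst (volume.restrict (Set.Ioc 0 π))
  refine hf.mul_bdd (c := 2 * b) (by
    apply Measurable.aestronglyMeasurable
    fun_prop) ?_
  rw [Measure.prod_restrict]
  filter_upwards [ae_restrict_mem (measurableSet_Ioi.prod measurableSet_Ioc)] with x hx
  have h := sub_cos_pos le_rfl hx.2
  have ht : 0 < x.1 := hx.1
  rw [norm_mul, norm_of_nonneg (exp_pos _).le]
  refine (mul_le_of_le_one_left (norm_nonneg _) ?_).trans (abs_sin_mul_sin_div_le le_rfl b h)
  rw [exp_le_one_iff]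
  nlinarith

theorem Pfirst_eq_single_integral (a b : ℕ) (ha : 1 ≤ a) (hb : 1 ≤ b) :
    Pfirst a b = (1 / Real.pi) * ∫ θ in (0 : ℝ)..Real.pi,
      (Real.cos (θ / 2) / Real.sin (θ / 2)) * Real.sin (b * θ) *
        ((2 - Real.cos θ) + Real.sqrt ((2 - Real.cos θ) ^ 2 - 1)) ^ (-(a : ℤ)) := by
  have hP : Pfirst a b = ∫ t in Set.Ioi (0 : ℝ), a * (exp (-1 * t) * besselI a t / t) *
      ∫ u in Set.Ioi t, b * (exp (-1 * u) * besselI b u / u) := by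
    simp_rw [Pfirst, integral_const_mul, neg_one_mul]
    rw [← integral_const_mul]
    congr 1
    funext t
    ring
  rw [hP, setIntegral_congr_fun measurableSet_Ioi fun t (ht : 0 < t) => by
    rw [integral_Ioi_besselI_density le_rfl b ht.le, mul_left_comm, ← integral_const_mul],
    integral_const_mul, integral_integral_swap (integrable_density_mul_survival a b),
    intervalIntegral.integral_of_le pi_pos.le]
  congr 1
  refine setIntegral_congr_fun measurableSet_Ioc fun θ hθ => ?_
  have hp : 1 < 2 - cos θ := by linarith [sub_cos_pos le_rfl hθ]
  rw [← integral_besselI_density_laplace hp ha, ← sin_div_one_sub_cos_eq_cot_half hθ,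
    ← integral_const_mul]
  congr 1
  funext t
  have : exp (-(2 - cos θ) * t) = exp (-1 * t) * exp (-(1 - cos θ) * t) := by
    rw [← exp_add]
    congr 1
    ring
  rw [this]
  ring
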